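/- Let A be a symmetric positive definite n×n matrix with eigenvalues in [m, M], f(x) = (1/2)xᵀAx, and let x ≠ 0 with θ_x the angle between Ax and x (so cos(θ_x) = xᵀAx/(‖x‖‖Ax‖)). Then max{‖z‖² : zᵀAz ≤ xᵀAx, zᵀx = 0} ≤ κ·cos(θ_x)·‖x‖², where κ = M/m. -/

import Mathlib

open scoped InnerProductSpace

theorem stmt_13 {n : ℕ} (A : EuclideanSpace ℝ (Fin n) →ₗ[ℝ] EuclideanSpace ℝ (Fin n))
    (m M : ℝ) (hm : 0 < m) (hmM : m ≤ M)
    (hsym : ∀ u v, ⟪A u, v⟫_ℝ = ⟪u, A v⟫_ℝ)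
    (hlow : ∀ u, m * ‖u‖ ^ 2 ≤ ⟪A u, u⟫_ℝ)
    (hup : ∀ u, ⟪A u, u⟫_ℝ ≤ M * ‖u‖ ^ 2)
    (x : EuclideanSpace ℝ (Fin n)) (hx : x ≠ 0) :
    ∀ z : EuclideanSpace ℝ (Fin n), ⟪A z, z⟫_ℝ ≤ ⟪A x, x⟫_ℝ → ⟪z, x⟫_ℝ = 0 →
      ‖z‖ ^ 2 ≤ M / m * (⟪A x, x⟫_ℝ / (‖x‖ * ‖A x‖)) * ‖x‖ ^ 2 := by
  intro z hz _
  have hM : 0 < M := lt_of_lt_of_le hm hmM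
  have hxn : 0 < ‖x‖ := norm_pos_iff.mpr hx
  have hq : 0 < ⟪A x, x⟫_ℝ := lt_of_lt_of_le (by positivity) (hlow x)
  have hAx : A x ≠ 0 := by
    intro h
    rw [h, inner_zero_left] at hq
    exact lt_irrefl _ hq
  have hyn : 0 < ‖A x‖ := norm_pos_iff.mpr hAx
  have h1 : 0 ≤ ⟪A (M • x - A x), M • x - A x⟫_ℝ :=
    le_trans (by positivity) (hlow _)
  have h2 : ⟪A (M • x - A x), M • x - A x⟫_ℝ
      = M ^ 2 * ⟪A x, x⟫_ℝ - 2 * M * ‖A x‖ ^ 2 + ⟪A (A x), A x⟫_ℝ := by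
    rw [map_sub, map_smul]
    simp only [inner_sub_left, inner_sub_right, real_inner_smul_left, real_inner_smul_right]
    rw [hsym (A x) x, real_inner_self_eq_norm_sq]
    ring
  have h3 := hup (A x)
  have h4 := hup x
  have h5 : ‖A x‖ ^ 2 ≤ M * ⟪A x, x⟫_ℝ := by
    have : M * ‖A x‖ ^ 2 ≤ M * (M * ⟪A x, x⟫_ℝ) := by nlinarith
    exact le_of_mul_le_mul_left this hM
  have h6 : ‖A x‖ ≤ M * ‖x‖ := by
    refine abs_le_of_sq_le_sq' ?_ (by positivity) |>.2
    nlinarith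
  have h7 : ‖z‖ ^ 2 ≤ ⟪A x, x⟫_ℝ / m := by
    rw [le_div_iff₀ hm]
    linarith [hlow z]
  refine h7.trans ?_
  have h8 : M / m * (⟪A x, x⟫_ℝ / (‖x‖ * ‖A x‖)) * ‖x‖ ^ 2
      = ⟪A x, x⟫_ℝ / m * (M * ‖x‖ / ‖A x‖) := by
    field_simp
  rw [h8]
  exact le_mul_of_one_le_right (by positivity) ((one_le_div hyn).mpr h6)
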